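/- arXiv:1310.6313 — 11 statements merged into one kernel-verified Lean document; each statement's English description precedes it below -/
import Mathlib

section
/- Let (X,d) be a metric space and let (x_n) and (y_n) be two sequences in X. Suppose that for every subset I of ℕ, the sets {x_i : i ∈ I} and {y_i : i ∈ I} are asymptotically alike (i.e. have finite Hausdorff distance). Then there exists k > 0 such that d(x_n, y_n) < k for all n ∈ ℕ. -/
theorem exists_forall_dist_lt_of_hausdorffEDist_ne_top {X : Type*} [PseudoMetricSpace X]
    {s t : Set X} (h : Metric.hausdorffEDist s t ≠ ⊤) :
    ∃ R : ℝ, ∀ a ∈ s, ∃ b ∈ t, dist a b < R := by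
  obtain ⟨R, hR⟩ := ENNReal.lt_iff_exists_nnreal_btwn.1 (lt_top_iff_ne_top.2 h)
  refine ⟨R, fun a ha ↦ ?_⟩
  obtain ⟨b, hb, hab⟩ := Metric.exists_edist_lt_of_hausdorffEDist_lt ha hR.1
  refine ⟨b, hb, ?_⟩
  rw [edist_nndist] at hab
  exact_mod_cast hab

theorem exists_forall_dist_le_of_dist_le {X ι : Type*} [PseudoMetricSpace X] {x y : ι → X}
    (h : ∀ I : Set ι, Metric.hausdorffEDist (x '' I) (y '' I) ≠ ⊤) (p : X) (r : ℝ) :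
    ∃ C : ℝ, ∀ n, dist (x n) p ≤ r → dist (x n) (y n) ≤ C := by
  obtain ⟨R, hR⟩ := exists_forall_dist_lt_of_hausdorffEDist_ne_top
    (Metric.hausdorffEDist_comm.trans_ne (h {n | dist (x n) p ≤ r}))
  refine ⟨R + r + r, fun n hn ↦ ?_⟩
  obtain ⟨_, ⟨j, hj, rfl⟩, hlt⟩ := hR (y n) ⟨n, hn, rfl⟩
  have hjp : dist (x j) p ≤ r := hj
  have h₁ := dist_triangle (y n) (x j) p
  have h₂ := dist_triangle_right (x n) (y n) p
  linarith

/-- Two families are not asymptotically alike along a sequence of indices that escapes to infinity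
fast enough. -/
theorem exists_hausdorffEDist_image_eq_top {X ι : Type*} [PseudoMetricSpace X] {x y : ι → X}
    (p : X)
    (h : ∀ r : ℝ, ∃ n, r < dist (x n) (y n) ∧ r < dist (x n) p ∧ r < dist (y n) p) :
    ∃ I : Set ι, Metric.hausdorffEDist (x '' I) (y '' I) = ⊤ := by
  obtain ⟨f, hf, hlt⟩ := exists_seq_of_forall_finset_exists
    (fun a : ℕ × ι ↦ (a.1 : ℝ) < dist (x a.2) (y a.2))
    (fun a b ↦ a.1 < b.1 ∧ dist (y a.2) p + b.1 < dist (x b.2) p ∧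
      dist (x a.2) p + a.1 < dist (y b.2) p) (by
    intro s _
    obtain ⟨N, hN⟩ := (s.image Prod.fst).bddAbove
    obtain ⟨A, hA⟩ := (s.image fun a ↦ dist (x a.2) p).bddAbove
    obtain ⟨B, hB⟩ := (s.image fun a ↦ dist (y a.2) p).bddAbove
    obtain ⟨n, h₁, h₂, h₃⟩ := h (|A| + |B| + (N + 1 : ℕ))
    have hA₀ := abs_nonneg A
    have hB₀ := abs_nonneg B
    refine ⟨(N + 1, n), by dsimp only; linarith, fun a ha ↦ ?_⟩
    have haN : a.1 ≤ N := hN (Finset.mem_coe.2 (Finset.mem_image_of_mem _ ha))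
    have haA : dist (x a.2) p ≤ A := hA (Finset.mem_coe.2 (Finset.mem_image_of_mem _ ha))
    have haB : dist (y a.2) p ≤ B := hB (Finset.mem_coe.2 (Finset.mem_image_of_mem _ ha))
    have haN' : (a.1 : ℝ) ≤ N := by exact_mod_cast haN
    have hA₁ := le_abs_self A
    have hB₁ := le_abs_self B
    push_cast at h₂ h₃
    refine ⟨by dsimp only; omega, ?_, ?_⟩
    · push_cast
      linarith
    · linarith)
  refine ⟨Set.range fun k ↦ (f k).2, by_contra fun hI ↦ ?_⟩
  obtain ⟨R, hR⟩ := exists_forall_dist_lt_of_hausdorffEDist_ne_top hI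
  obtain ⟨k, hk⟩ := exists_nat_ge R
  have hmono : StrictMono fun k ↦ (f k).1 := fun m n hmn ↦ (hlt m n hmn).1
  have hkf : (k : ℝ) ≤ (f k).1 := by exact_mod_cast hmono.le_apply (x := k)
  obtain ⟨_, ⟨_, ⟨j, rfl⟩, rfl⟩, hd⟩ := hR (x (f k).2) ⟨_, ⟨k, rfl⟩, rfl⟩
  dsimp only at hd
  rcases lt_trichotomy j k with hjk | rfl | hjk
  · have h₁ := (hlt j k hjk).2.1
    have h₂ := dist_triangle (x (f k).2) (y (f j).2) p
    linarith
  · have h₁ := hf j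
    linarith
  · have h₁ := (hlt k j hjk).2.2
    have h₂ := dist_triangle_left (y (f j).2) p (x (f k).2)
    linarith

/-- In a metric space, two subsets `A` and `B` are *asymptotically alike* if their
Hausdorff distance is finite.  (Mathlib's `EMetric.hausdorffEdist` satisfies the
conventions `d_H(∅,∅) = 0` and `d_H(∅,A) = ∞` for nonempty `A`.) -/
theorem stmt_0 {X : Type*} [MetricSpace X] (x y : ℕ → X)
    (h : ∀ I : Set ℕ, EMetric.hausdorffEdist (x '' I) (y '' I) ≠ ⊤) :
    ∃ k > (0 : ℝ), ∀ n : ℕ, dist (x n) (y n) < k := by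
  by_contra! hunb
  have hsymm : ∀ I : Set ℕ, Metric.hausdorffEDist (y '' I) (x '' I) ≠ ⊤ := fun I ↦
    Metric.hausdorffEDist_comm.trans_ne (h I)
  obtain ⟨I, hI⟩ := exists_hausdorffEDist_image_eq_top (x := x) (y := y) (x 0) fun r ↦ by
    obtain ⟨A, hA⟩ := exists_forall_dist_le_of_dist_le h (x 0) r
    obtain ⟨B, hB⟩ := exists_forall_dist_le_of_dist_le hsymm (x 0) r
    obtain ⟨n, hn⟩ := hunb (|r| + |A| + |B| + 1) (by positivity)
    have hr₀ := abs_nonneg r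
    have hA₀ := abs_nonneg A
    have hB₀ := abs_nonneg B
    have hr₁ := le_abs_self r
    have hA₁ := le_abs_self A
    have hB₁ := le_abs_self B
    refine ⟨n, by linarith, lt_of_not_ge fun hle ↦ ?_, lt_of_not_ge fun hle ↦ ?_⟩
    · linarith [hA n hle]
    · linarith [hB n hle, dist_comm (x n) (y n)]
  exact h I hI
end

section
/- Let X and Y be metric spaces and let f : X → Y be a proper map (i.e. preimages of bounded sets are bounded). Then f is a coarse map if and only if for all subsets A, B of X that are asymptotically alike, the images f(A) and f(B) are asymptotically alike. -/
open Bornology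

/-- A map between metric spaces is a *coarse map* if it is proper (preimages of bounded
sets are bounded) and for each `r > 0` there exists `s > 0` such that
`dist x x' < r` implies `dist (f x) (f x') < s`. -/
def CoarseMapMetric {X Y : Type*} [MetricSpace X] [MetricSpace Y] (f : X → Y) : Prop :=
  (∀ B : Set Y, IsBounded B → IsBounded (f ⁻¹' B)) ∧
  ∀ r > (0 : ℝ), ∃ s > (0 : ℝ), ∀ x x' : X, dist x x' < r → dist (f x) (f x') < s

/-- Two sets are at finite Hausdorff distance iff each lies in a uniform neighbourhood of
the other. -/
theorem hausdorffEDist_ne_top_iff_exists_dist_lt {X : Type*} [PseudoMetricSpace X]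
    {A B : Set X} :
    Metric.hausdorffEDist A B ≠ ⊤ ↔
      ∃ r : ℝ, (∀ a ∈ A, ∃ b ∈ B, dist a b < r) ∧ ∀ b ∈ B, ∃ a ∈ A, dist b a < r := by
  constructor
  · intro h
    obtain ⟨r, hr⟩ := ENNReal.lt_iff_exists_nnreal_btwn.1 (lt_top_iff_ne_top.2 h)
    refine ⟨r, fun a ha => ?_, fun b hb => ?_⟩
    · obtain ⟨b, hb, hab⟩ := Metric.exists_edist_lt_of_hausdorffEDist_lt ha hr.1
      exact ⟨b, hb, by rwa [edist_nndist, ENNReal.coe_lt_coe] at hab⟩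
    · rw [Metric.hausdorffEDist_comm] at hr
      obtain ⟨a, ha, hab⟩ := Metric.exists_edist_lt_of_hausdorffEDist_lt hb hr.1
      exact ⟨a, ha, by rwa [edist_nndist, ENNReal.coe_lt_coe] at hab⟩
  · rintro ⟨r, hA, hB⟩
    refine ne_top_of_le_ne_top (ENNReal.ofReal_ne_top (r := r))
      (Metric.hausdorffEDist_le_of_mem_edist (fun a ha => ?_) fun b hb => ?_)
    · obtain ⟨b, hb, hab⟩ := hA a ha
      exact ⟨b, hb, by rw [edist_dist]; exact ENNReal.ofReal_le_ofReal hab.le⟩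
    · obtain ⟨a, ha, hab⟩ := hB b hb
      exact ⟨a, ha, by rw [edist_dist]; exact ENNReal.ofReal_le_ofReal hab.le⟩

/-- A map preserving finiteness of the Hausdorff distance sends bounded sets to bounded sets. -/
theorem isBounded_image_of_hausdorffEDist_image_ne_top {X Y : Type*} [PseudoMetricSpace X]
    [PseudoMetricSpace Y] {f : X → Y}
    (h : ∀ A B : Set X, Metric.hausdorffEDist A B ≠ ⊤ →
      Metric.hausdorffEDist (f '' A) (f '' B) ≠ ⊤)
    {K : Set X} (hK : IsBounded K) : IsBounded (f '' K) := by
  rcases K.eq_empty_or_nonempty with rfl | ⟨p, hp⟩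
  · simp
  obtain ⟨r, hr, -⟩ := hausdorffEDist_ne_top_iff_exists_dist_lt.1 <|
    h K {p} <| Metric.hausdorffEDist_ne_top_of_nonempty_of_bounded ⟨p, hp⟩
      (Set.singleton_nonempty p) hK isBounded_singleton
  refine Metric.isBounded_ball (x := f p) (r := r) |>.subset fun y hy => ?_
  simpa using hr y hy

/-- If `f` is proper and sends bounded sets to bounded sets, then it spreads `r`-close points by
a bounded amount as long as one of the images lies in a given bounded set. -/
theorem exists_forall_dist_lt_of_image_mem_isBounded {X Y : Type*} [PseudoMetricSpace X]
    [PseudoMetricSpace Y] {f : X → Y} (hf : ∀ B : Set Y, IsBounded B → IsBounded (f ⁻¹' B))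
    (hb : ∀ K : Set X, IsBounded K → IsBounded (f '' K)) (r : ℝ) {K : Set Y}
    (hK : IsBounded K) :
    ∃ s : ℝ, ∀ x x', dist x x' < r → f x ∈ K → dist (f x) (f x') < s := by
  obtain ⟨s, hs⟩ := Metric.isBounded_iff.1 <|
    hb _ ((hf K hK).union ((hf K hK).thickening (δ := r)))
  refine ⟨s + 1, fun x x' hxx' hx => (hs ⟨x, Or.inl hx, rfl⟩ ⟨x', Or.inr ?_, rfl⟩).trans_lt
    (lt_add_one s)⟩
  exact Metric.mem_thickening_iff.2 ⟨x, hx, by rwa [dist_comm]⟩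

/-- A proper map `f` between metric spaces is a coarse map iff it sends pairs of
asymptotically alike subsets (i.e. subsets at finite Hausdorff distance) to pairs of
asymptotically alike subsets. -/
theorem stmt_1 {X Y : Type*} [MetricSpace X] [MetricSpace Y] (f : X → Y)
    (hf : ∀ B : Set Y, IsBounded B → IsBounded (f ⁻¹' B)) :
    CoarseMapMetric f ↔
      ∀ A B : Set X, EMetric.hausdorffEdist A B ≠ ⊤ →
        EMetric.hausdorffEdist (f '' A) (f '' B) ≠ ⊤ := by
  constructor
  · rintro ⟨-, hc⟩ A B hAB
    obtain ⟨r, hA, hB⟩ := hausdorffEDist_ne_top_iff_exists_dist_lt.1 hAB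
    obtain ⟨s, -, hs⟩ := hc (max r 1) (by positivity)
    refine hausdorffEDist_ne_top_iff_exists_dist_lt.2 ⟨s, ?_, ?_⟩
    · rintro _ ⟨a, ha, rfl⟩
      obtain ⟨b, hb, hab⟩ := hA a ha
      exact ⟨f b, ⟨b, hb, rfl⟩, hs a b (lt_max_of_lt_left hab)⟩
    · rintro _ ⟨b, hb, rfl⟩
      obtain ⟨a, ha, hab⟩ := hB b hb
      exact ⟨f a, ⟨a, ha, rfl⟩, hs b a (lt_max_of_lt_left hab)⟩
  · intro h
    refine ⟨hf, fun r hr => ?_⟩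
    by_contra! hn
    have far (K : Set Y) (hK : IsBounded K) (n : ℕ) : ∃ x x', dist x x' < r ∧
        (n : ℝ) ≤ dist (f x) (f x') ∧ f x ∉ K ∧ f x' ∉ K := by
      obtain ⟨s, hs⟩ := exists_forall_dist_lt_of_image_mem_isBounded hf
        (fun K => isBounded_image_of_hausdorffEDist_image_ne_top h) r hK
      obtain ⟨x, x', hx, hfx⟩ := hn (max s (n + 1)) (lt_max_of_lt_right (by positivity))
      have hsx := (le_max_left _ _).trans hfx
      have hnx := (le_max_right _ _).trans hfx
      refine ⟨x, x', hx, by linarith, fun hxK => (hs x x' hx hxK).not_ge hsx,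
        fun hxK => (hs x' x (by rwa [dist_comm]) hxK).not_ge (by rwa [dist_comm])⟩
    obtain ⟨u, hu, huv⟩ := exists_seq_of_forall_finset_exists
      (fun p : ℕ × X × X => dist p.2.1 p.2.2 < r ∧ (p.1 : ℝ) ≤ dist (f p.2.1) (f p.2.2))
      (fun p q => p.1 < q.1 ∧ (q.1 : ℝ) ≤ dist (f p.2.1) (f q.2.2) ∧
        (q.1 : ℝ) ≤ dist (f q.2.1) (f p.2.2)) (by
        intro s _
        let n := s.sup Prod.fst + 1
        obtain ⟨x, x', hx, hfx, h1, h2⟩ := far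
          (⋃ p ∈ s, (Metric.ball (f p.2.1) n ∪ Metric.ball (f p.2.2) n))
          ((isBounded_biUnion_finset s).2 fun p _ => Metric.isBounded_ball.union
            Metric.isBounded_ball) n
        simp only [Set.mem_iUnion, Set.mem_union, Metric.mem_ball, not_exists, not_or,
          not_lt] at h1 h2
        refine ⟨(n, x, x'), ⟨hx, hfx⟩, fun p hp =>
          ⟨Nat.lt_succ_of_le (Finset.le_sup (f := Prod.fst) hp), ?_, (h1 p hp).2⟩⟩
        rw [dist_comm]
        exact (h2 p hp).1)
    have hmono : StrictMono fun n => (u n).1 := fun m n hmn => (huv m n hmn).1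
    obtain ⟨C, hC, -⟩ := hausdorffEDist_ne_top_iff_exists_dist_lt.1 <|
      h (Set.range fun n => (u n).2.1) (Set.range fun n => (u n).2.2) <|
        hausdorffEDist_ne_top_iff_exists_dist_lt.2 ⟨r, by
          rintro _ ⟨n, rfl⟩
          exact ⟨_, ⟨n, rfl⟩, (hu n).1⟩, by
          rintro _ ⟨n, rfl⟩
          exact ⟨_, ⟨n, rfl⟩, by rw [dist_comm]; exact (hu n).1⟩⟩
    obtain ⟨k, hk⟩ := exists_nat_ge C
    obtain ⟨_, ⟨_, ⟨j, rfl⟩, rfl⟩, hj⟩ := hC _ ⟨_, ⟨k, rfl⟩, rfl⟩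
    have hku : (k : ℝ) ≤ (u k).1 := by exact_mod_cast hmono.le_apply
    have huk : ((u k).1 : ℝ) ≤ dist (f (u k).2.1) (f (u j).2.2) := by
      rcases lt_trichotomy j k with hjk | rfl | hkj
      · exact (huv j k hjk).2.2
      · exact (hu j).2
      · exact le_trans (by exact_mod_cast (hmono hkj).le) (huv k j hkj).2.1
    exact (hk.trans (hku.trans huk)).not_gt hj
end

section
/- Let (X,λ₁) and (Y,λ₂) be AS.R. spaces and let f : X → Y and g : X → Y be close maps. If f is an AS.R. mapping then so is g, and if f is an asymptotic equivalence then so is g. -/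
/-- An *asymptotic resemblance* (AS.R.): an equivalence relation on the power set
satisfying the union and splitting axioms. -/
structure IsASR {X : Type*} (l : Set X → Set X → Prop) : Prop where
  equiv : Equivalence l
  union : ∀ ⦃A₁ B₁ A₂ B₂ : Set X⦄, l A₁ B₁ → l A₂ B₂ → l (A₁ ∪ A₂) (B₁ ∪ B₂)
  split : ∀ ⦃B₁ B₂ A : Set X⦄, l (B₁ ∪ B₂) A → B₁.Nonempty → B₂.Nonempty →
    ∃ A₁ A₂ : Set X, A₁.Nonempty ∧ A₂.Nonempty ∧ A = A₁ ∪ A₂ ∧ l B₁ A₁ ∧ l B₂ A₂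

/-- A subset of an AS.R. space is *bounded* if it is empty or asymptotically alike to a
singleton. -/
def ASRBounded {X : Type*} (l : Set X → Set X → Prop) (A : Set X) : Prop :=
  A = ∅ ∨ ∃ x : X, l A {x}

/-- `f : X → Y` is an *AS.R. mapping* if preimages of bounded sets are bounded and
`A λ₁ B` implies `f(A) λ₂ f(B)`. -/
def ASRMapping {X Y : Type*} (l₁ : Set X → Set X → Prop) (l₂ : Set Y → Set Y → Prop)
    (f : X → Y) : Prop :=
  (∀ B : Set Y, ASRBounded l₂ B → ASRBounded l₁ (f ⁻¹' B)) ∧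
  ∀ A B : Set X, l₁ A B → l₂ (f '' A) (f '' B)

/-- Two maps `f g : X → Y` into an AS.R. space `(Y, l₂)` are *close* if
`f(A) λ₂ g(A)` for every subset `A` of `X`. -/
def CloseMaps {X Y : Type*} (l₂ : Set Y → Set Y → Prop) (f g : X → Y) : Prop :=
  ∀ A : Set X, l₂ (f '' A) (g '' A)

/-- An AS.R. mapping `f : X → Y` is an *asymptotic equivalence* if there is an AS.R.
mapping `g : Y → X` with `g ∘ f` close to `id X` and `f ∘ g` close to `id Y`. -/
def AsympEquivMap {X Y : Type*} (l₁ : Set X → Set X → Prop) (l₂ : Set Y → Set Y → Prop)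
    (f : X → Y) : Prop :=
  ASRMapping l₁ l₂ f ∧ ∃ g : Y → X, ASRMapping l₂ l₁ g ∧
    CloseMaps l₁ (g ∘ f) id ∧ CloseMaps l₂ (f ∘ g) id

theorem ASRBounded.mono {X : Type*} {l : Set X → Set X → Prop} (hl : IsASR l) {A B : Set X}
    (hB : ASRBounded l B) (hAB : A ⊆ B) : ASRBounded l A := by
  rcases A.eq_empty_or_nonempty with hA | hA
  · exact Or.inl hA
  rcases hB with rfl | ⟨x, hx⟩
  · exact Or.inl (Set.subset_empty_iff.mp hAB)
  rcases (B \ A).eq_empty_or_nonempty with hd | hd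
  · exact Or.inr ⟨x, by rwa [hAB.antisymm (Set.sdiff_eq_empty.mp hd)]⟩
  rw [← Set.union_sdiff_cancel hAB] at hx
  obtain ⟨A₁, A₂, hA₁, -, hU, h, -⟩ := hl.split hx hA hd
  have hsub : A₁ ⊆ {x} := hU ▸ Set.subset_union_left
  exact Or.inr ⟨x, hA₁.subset_singleton_iff.mp hsub ▸ h⟩

theorem ASRBounded.congr {X : Type*} {l : Set X → Set X → Prop} (hl : IsASR l) {A B : Set X}
    (hB : ASRBounded l B) (hne : B.Nonempty) (hAB : l A B) : ASRBounded l A := by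
  obtain ⟨x, hx⟩ := hB.resolve_left hne.ne_empty
  exact Or.inr ⟨x, hl.equiv.trans hAB hx⟩

theorem ASRMapping.of_close {X Y : Type*} {l₁ : Set X → Set X → Prop} {l₂ : Set Y → Set Y → Prop}
    (hl₁ : IsASR l₁) (hl₂ : IsASR l₂) {f g : X → Y} (hfg : CloseMaps l₂ f g)
    (hf : ASRMapping l₁ l₂ f) : ASRMapping l₁ l₂ g := by
  refine ⟨fun B hB => ?_, fun A B hAB =>
    hl₂.equiv.trans (hl₂.equiv.symm (hfg A)) (hl₂.equiv.trans (hf.2 A B hAB) (hfg B))⟩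
  rcases (g ⁻¹' B).eq_empty_or_nonempty with hne | hne
  · exact Or.inl hne
  have hg : ASRBounded l₂ (g '' (g ⁻¹' B)) := hB.mono hl₂ (Set.image_preimage_subset g B)
  exact (hf.1 _ (hg.congr hl₂ (hne.image g) (hfg _))).mono hl₁ (Set.subset_preimage_image f _)

/-- If `f` and `g` are close maps between AS.R. spaces, then `g` is an AS.R. mapping
whenever `f` is, and `g` is an asymptotic equivalence whenever `f` is. -/
theorem stmt_7 {X Y : Type*} (l₁ : Set X → Set X → Prop) (l₂ : Set Y → Set Y → Prop)
    (hl₁ : IsASR l₁) (hl₂ : IsASR l₂) (f g : X → Y) (hfg : CloseMaps l₂ f g) :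
    (ASRMapping l₁ l₂ f → ASRMapping l₁ l₂ g) ∧
    (AsympEquivMap l₁ l₂ f → AsympEquivMap l₁ l₂ g) := by
  refine ⟨ASRMapping.of_close hl₁ hl₂ hfg, ?_⟩
  rintro ⟨hf, h, hh, hhf, hfh⟩
  refine ⟨hf.of_close hl₁ hl₂ hfg, h, hh, fun A => ?_, fun A => ?_⟩
  · have hA := hhf A
    rw [Set.image_comp] at hA ⊢
    exact hl₁.equiv.trans (hl₁.equiv.symm (hh.2 _ _ (hfg A))) hA
  · have hA := hfh A
    rw [Set.image_comp] at hA ⊢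
    exact hl₂.equiv.trans (hl₂.equiv.symm (hfg _)) hA
end

section
/- Let (X,λ) and (Y,λ') be AS.R. spaces, let f : X → Y be an asymptotic equivalence, and let C be a nonempty subset of X. Then the restriction f|_C : (C, λ_C) → (f(C), λ'_{f(C)}) is an asymptotic equivalence, where λ_C and λ'_{f(C)} are the subspace AS.R.s induced on C and f(C). -/
/-- The *subspace AS.R.* on a subset `Y ⊆ X`: two subsets of `Y` are related iff they are
related (as subsets of `X`) by the ambient relation. -/
def SubspaceASR {X : Type*} (l : Set X → Set X → Prop) (Y : Set X) :
    Set Y → Set Y → Prop :=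
  fun A B => l (Subtype.val '' A) (Subtype.val '' B)

/-- A nonempty subset of a set asymptotically alike to a singleton is alike to that singleton. -/
lemma IsASR.rel_singleton_of_subset {X : Type*} {l : Set X → Set X → Prop} (hl : IsASR l)
    {A B : Set X} {x : X} (hAB : A ⊆ B) (hA : A.Nonempty) (hB : l B {x}) : l A {x} := by
  rw [← Set.union_eq_self_of_subset_left hAB] at hB
  obtain ⟨A₁, A₂, h₁, -, h, hl₁, -⟩ := hl.split hB hA (hA.mono hAB)
  have hA₁ : A₁ = {x} :=
    h₁.subset_singleton_iff.mp (h ▸ Set.subset_union_left)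
  rwa [hA₁] at hl₁

/-- An asymptotic equivalence reflects asymptotic resemblance. -/
lemma AsympEquivMap.rel_of_image {X Y : Type*} {l : Set X → Set X → Prop}
    {l' : Set Y → Set Y → Prop} {f : X → Y} (hl : IsASR l) (hf : AsympEquivMap l l' f)
    {A B : Set X} (h : l' (f '' A) (f '' B)) : l A B := by
  obtain ⟨-, g, hg, hgf, -⟩ := hf
  have hA := hgf A
  have hB := hgf B
  rw [Set.image_id, Set.image_comp] at hA hB
  exact hl.equiv.trans (hl.equiv.symm hA) (hl.equiv.trans (hg.2 _ _ h) hB)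

/-- A surjection that preserves and reflects asymptotic resemblance is an asymptotic
equivalence, any section being an inverse up to closeness. -/
lemma AsympEquivMap.of_surjective {X Y : Type*} {l : Set X → Set X → Prop}
    {l' : Set Y → Set Y → Prop} {f : X → Y} (hrefl : ∀ A, l' A A)
    (hsub : ∀ (A B : Set Y) (y : Y), A ⊆ B → A.Nonempty → l' B {y} → l' A {y})
    (hsurj : Function.Surjective f) (hf : ∀ A B, l A B ↔ l' (f '' A) (f '' B)) :
    AsympEquivMap l l' f := by
  obtain ⟨g, hg⟩ := hsurj.hasRightInverse
  have hfg : ∀ A : Set Y, f '' (g '' A) = A := hg.leftInverse.image_image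
  refine ⟨⟨?_, fun A B => (hf A B).mp⟩, g, ⟨?_, ?_⟩, ?_, ?_⟩
  · rintro B (rfl | ⟨y, hy⟩)
    · exact Or.inl Set.preimage_empty
    · obtain ⟨x, rfl⟩ := hsurj y
      refine Or.inr ⟨x, (hf _ _).mpr ?_⟩
      rwa [Set.image_preimage_eq B hsurj, Set.image_singleton]
  · rintro B (rfl | ⟨x, hx⟩)
    · exact Or.inl Set.preimage_empty
    · rcases (g ⁻¹' B).eq_empty_or_nonempty with h | h
      · exact Or.inl h
      · refine Or.inr ⟨f x, hsub _ (f '' B) _ (fun y hy => ⟨g y, hy, hg y⟩) h ?_⟩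
        simpa using (hf _ _).mp hx
  · intro A B h
    rwa [hf, hfg, hfg]
  · intro A
    rw [hf, Set.image_id, Set.image_comp, hfg]
    exact hrefl _
  · intro A
    rw [Set.image_id, Set.image_comp, hfg]
    exact hrefl _

/-- If `f : X → Y` is an asymptotic equivalence between AS.R. spaces and `C ⊆ X` is
nonempty, then the restriction `f|_C : C → f(C)` is an asymptotic equivalence with
respect to the subspace AS.R.s on `C` and `f(C)`. -/
theorem stmt_8 {X Y : Type*} (l : Set X → Set X → Prop) (l' : Set Y → Set Y → Prop)
    (hl : IsASR l) (hl' : IsASR l') (f : X → Y) (hf : AsympEquivMap l l' f)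
    (C : Set X) (hC : C.Nonempty) :
    AsympEquivMap (SubspaceASR l C) (SubspaceASR l' (f '' C))
      (fun c : C => (⟨f c, Set.mem_image_of_mem f c.2⟩ : f '' C)) := by
  have himage : ∀ A : Set C, Subtype.val ''
      ((fun c : C => (⟨f c, Set.mem_image_of_mem f c.2⟩ : f '' C)) '' A) =
        f '' (Subtype.val '' A) := fun A => by
    rw [Set.image_image, Set.image_image]
  refine AsympEquivMap.of_surjective (fun A => hl'.equiv.refl _) ?_ ?_ fun A B => ?_
  · intro A B y hAB hA hB
    simp only [SubspaceASR, Set.image_singleton] at hB ⊢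
    exact hl'.rel_singleton_of_subset (Set.image_mono hAB) (hA.image _) hB
  · rintro ⟨_, x, hx, rfl⟩
    exact ⟨⟨x, hx⟩, rfl⟩
  · simp only [SubspaceASR, himage]
    exact ⟨hf.1.2 _ _, hf.rel_of_image hl⟩
end

section
/- An AS.R. space (X,λ) is asymptotically connected if and only if for all nonempty subsets A and B of X, finiteness of the symmetric difference A Δ B implies A λ B. -/
/-- In an asymptotically connected AS.R. space, adding finitely many points to a nonempty set
gives an asymptotically alike set. -/
theorem IsASR.finite_union {X : Type*} {l : Set X → Set X → Prop} (hl : IsASR l)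
    (hc : ∀ x y : X, l {x} {y}) {A F : Set X} (hA : A.Nonempty) (hF : F.Finite) :
    l (F ∪ A) A := by
  induction F, hF using Set.Finite.induction_on with
  | empty => simpa using hl.equiv.refl A
  | @insert x F _ _ ih =>
    obtain ⟨a, ha⟩ := hA
    have h := hl.union (hc x a) ih
    rwa [← Set.union_assoc, Set.singleton_union, Set.singleton_union,
      Set.insert_eq_of_mem ha] at h

/-- An AS.R. space is asymptotically connected (`{x} λ {y}` for all `x, y`) iff any two
nonempty subsets with finite symmetric difference are asymptotically alike. -/
theorem stmt_9 {X : Type*} (l : Set X → Set X → Prop) (hl : IsASR l) :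
    (∀ x y : X, l {x} {y}) ↔
      ∀ A B : Set X, A.Nonempty → B.Nonempty → (symmDiff A B).Finite → l A B := by
  refine ⟨fun hc A B hA hB hAB => ?_, fun h x y => ?_⟩
  · rw [Set.symmDiff_def, Set.finite_union] at hAB
    have hBA := hl.finite_union hc hA hAB.2
    have hAB' := hl.finite_union hc hB hAB.1
    rw [Set.sdiff_union_self] at hBA hAB'
    rw [Set.union_comm] at hBA
    exact hl.equiv.trans (hl.equiv.symm hBA) hAB'
  · refine h {x} {y} (Set.singleton_nonempty x) (Set.singleton_nonempty y) ?_
    rw [Set.symmDiff_def]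
    exact ((Set.finite_singleton x).sdiff).union (Set.finite_singleton y).sdiff
end

section
/- Let λ be an AS.R. on a set X and suppose there exists at least one coarse structure on X whose associated AS.R. is λ. Define ℰ_λ to be the family of all E ⊆ X × X such that π₁(F) λ π₂(F) for every subset F of E, where π₁, π₂ are the projections onto the first and second coordinates. Then ℰ_λ is a coarse structure on X, the AS.R. associated to ℰ_λ equals λ, and ℰ ⊆ ℰ_λ for every coarse structure ℰ on X whose associated AS.R. is λ. -/
/-- A (unitary) *coarse structure* on `X`: a family of subsets of `X × X` containing the
diagonal and closed under subsets, inverses, compositions and finite unions. -/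
structure IsCoarseStructure {X : Type*} (E : Set (Set (X × X))) : Prop where
  diag : {p : X × X | p.1 = p.2} ∈ E
  subset : ∀ ⦃e f : Set (X × X)⦄, e ∈ E → f ⊆ e → f ∈ E
  inv : ∀ ⦃e : Set (X × X)⦄, e ∈ E → {p : X × X | (p.2, p.1) ∈ e} ∈ E
  comp : ∀ ⦃e f : Set (X × X)⦄, e ∈ E → f ∈ E →
    {p : X × X | ∃ z : X, (p.1, z) ∈ f ∧ (z, p.2) ∈ e} ∈ E
  union : ∀ ⦃e f : Set (X × X)⦄, e ∈ E → f ∈ E → e ∪ f ∈ E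

/-- `E(A) = {y | ∃ x ∈ A, (x, y) ∈ E}`. -/
def entImage {X : Type*} (e : Set (X × X)) (A : Set X) : Set X :=
  {y : X | ∃ x ∈ A, (x, y) ∈ e}

/-- The AS.R. associated to a coarse structure: `A λ_ℰ B` iff there is an entourage `E`
with `A ⊆ E(B)` and `B ⊆ E(A)`. -/
def coarseASR {X : Type*} (E : Set (Set (X × X))) (A B : Set X) : Prop :=
  ∃ e ∈ E, A ⊆ entImage e B ∧ B ⊆ entImage e A

/-- The family `ℰ_λ` of all `E ⊆ X × X` with `π₁(F) λ π₂(F)` for every `F ⊆ E`. -/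
def asrEntourages {X : Type*} (l : Set X → Set X → Prop) : Set (Set (X × X)) :=
  {e : Set (X × X) | ∀ f ⊆ e, l (Prod.fst '' f) (Prod.snd '' f)}

theorem IsASR.isCoarseStructure_asrEntourages {X : Type*} {l : Set X → Set X → Prop}
    (hl : IsASR l) : IsCoarseStructure (asrEntourages l) where
  diag f hf := by
    have h : Prod.fst '' f = Prod.snd '' f := Set.image_congr fun p hp => hf hp
    rw [h]
    exact hl.equiv.refl _
  subset e f he hfe g hg := he g (hg.trans hfe)
  inv e he f hf := by
    have h := he (Prod.swap '' f) (by rintro _ ⟨p, hp, rfl⟩; exact hf hp)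
    simp only [Set.image_image, Prod.fst_swap, Prod.snd_swap] at h
    exact hl.equiv.symm h
  comp e f he hf g hg := by
    have h₁ := hf {p | p ∈ f ∧ ∃ y, (p.1, y) ∈ g ∧ (p.2, y) ∈ e} fun p hp => hp.1
    have h₂ := he {p | p ∈ e ∧ ∃ x, (x, p.2) ∈ g ∧ (x, p.1) ∈ f} fun p hp => hp.1
    convert hl.equiv.trans h₁ (?_ : l _ _) using 1
    · ext x
      constructor
      · rintro ⟨⟨x, y⟩, hp, rfl⟩
        obtain ⟨z, hz, hz'⟩ := hg hp
        exact ⟨(x, z), ⟨hz, y, hp, hz'⟩, rfl⟩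
      · rintro ⟨⟨x, z⟩, ⟨-, y, hp, -⟩, rfl⟩
        exact ⟨(x, y), hp, rfl⟩
    · convert h₂ using 1
      · ext z
        constructor
        · rintro ⟨⟨x, z⟩, ⟨hf, y, hp, he⟩, rfl⟩
          exact ⟨(z, y), ⟨he, x, hp, hf⟩, rfl⟩
        · rintro ⟨⟨z, y⟩, ⟨he, x, hp, hf⟩, rfl⟩
          exact ⟨(x, z), ⟨hf, y, hp, he⟩, rfl⟩
      · ext y
        constructor
        · rintro ⟨⟨x, y⟩, hp, rfl⟩
          obtain ⟨z, hz, hz'⟩ := hg hp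
          exact ⟨(z, y), ⟨hz', x, hp, hz⟩, rfl⟩
        · rintro ⟨⟨z, y⟩, ⟨-, x, hp, -⟩, rfl⟩
          exact ⟨(x, y), hp, rfl⟩
  union e f he hf g hg := by
    have h := hl.union (he (g ∩ e) Set.inter_subset_right) (hf (g ∩ f) Set.inter_subset_right)
    rwa [← Set.image_union, ← Set.image_union, ← Set.inter_union_distrib_left,
      Set.inter_eq_left.2 hg] at h

theorem IsCoarseStructure.subset_asrEntourages {X : Type*} {E : Set (Set (X × X))}
    (hE : IsCoarseStructure E) : E ⊆ asrEntourages (coarseASR E) := by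
  intro e he f hf
  have hfE := hE.subset he hf
  refine ⟨_, hE.union hfE (hE.inv hfE), ?_, ?_⟩
  · rintro _ ⟨p, hp, rfl⟩
    exact ⟨p.2, ⟨p, hp, rfl⟩, Or.inr hp⟩
  · rintro _ ⟨p, hp, rfl⟩
    exact ⟨p.1, ⟨p, hp, rfl⟩, Or.inl hp⟩

theorem exists_subset_of_subset_entImage {X : Type*} {l : Set X → Set X → Prop}
    {e : Set (X × X)} (he : e ∈ asrEntourages l) {A B : Set X} (h : A ⊆ entImage e B) :
    ∃ C ⊆ B, l C A := by
  refine ⟨Prod.fst '' {p | p ∈ e ∧ p.1 ∈ B ∧ p.2 ∈ A}, ?_, ?_⟩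
  · rintro _ ⟨p, hp, rfl⟩
    exact hp.2.1
  · convert he {p | p ∈ e ∧ p.1 ∈ B ∧ p.2 ∈ A} (fun p hp => hp.1) using 1
    ext y
    constructor
    · intro hy
      obtain ⟨x, hx, hxy⟩ := h hy
      exact ⟨(x, y), ⟨hxy, hx, hy⟩, rfl⟩
    · rintro ⟨p, hp, rfl⟩
      exact hp.2.2

theorem IsASR.of_coarseASR_asrEntourages {X : Type*} {l : Set X → Set X → Prop}
    (hl : IsASR l) {A B : Set X} (h : coarseASR (asrEntourages l) A B) : l A B := by
  obtain ⟨e, he, hA, hB⟩ := h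
  obtain ⟨B', hB', hBA⟩ := exists_subset_of_subset_entImage he hA
  obtain ⟨A', hA', hAB⟩ := exists_subset_of_subset_entImage he hB
  have h := hl.union hAB (hl.equiv.symm hBA)
  rwa [Set.union_eq_right.2 hA', Set.union_eq_left.2 hB'] at h

/-- If `l` is an AS.R. on `X` induced by at least one coarse structure, then the family
`ℰ_λ` of all `E ⊆ X × X` such that `π₁(F) λ π₂(F)` for every `F ⊆ E` is a coarse
structure inducing `l`, and it contains every coarse structure inducing `l`. -/
theorem stmt_10 {X : Type*} (l : Set X → Set X → Prop) (hl : IsASR l)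
    (hex : ∃ E : Set (Set (X × X)), IsCoarseStructure E ∧ coarseASR E = l) :
    IsCoarseStructure {e : Set (X × X) | ∀ f ⊆ e, l (Prod.fst '' f) (Prod.snd '' f)} ∧
    coarseASR {e : Set (X × X) | ∀ f ⊆ e, l (Prod.fst '' f) (Prod.snd '' f)} = l ∧
    ∀ E : Set (Set (X × X)), IsCoarseStructure E → coarseASR E = l →
      E ⊆ {e : Set (X × X) | ∀ f ⊆ e, l (Prod.fst '' f) (Prod.snd '' f)} := by
  refine ⟨hl.isCoarseStructure_asrEntourages, ?_, ?_⟩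
  · obtain ⟨E, hE, rfl⟩ := hex
    ext A B
    refine ⟨hl.of_coarseASR_asrEntourages, ?_⟩
    rintro ⟨e, he, h⟩
    exact ⟨e, hE.subset_asrEntourages he, h⟩
  · rintro E hE rfl
    exact hE.subset_asrEntourages
end

section
/- Let (X,d) be a metric space with associated AS.R. λ (A λ B iff d_H(A,B) < ∞), and let x₀ ∈ X. Two unbounded subsets A and B of X are asymptotically disjoint if and only if lim_{r→∞} d(A \ B(x₀,r), B \ B(x₀,r)) = ∞, i.e. for every N > 0 there exists R > 0 such that for all r ≥ R, every a ∈ A with d(a,x₀) ≥ r and every b ∈ B with d(b,x₀) ≥ r satisfy d(a,b) > N. -/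
/-- A subset of a metric space is *bounded* for the AS.R. associated to the metric iff it
is empty or at finite Hausdorff distance from some singleton. -/
def MetricASRBounded {X : Type*} [MetricSpace X] (A : Set X) : Prop :=
  A = ∅ ∨ ∃ x : X, EMetric.hausdorffEdist A {x} ≠ ⊤

/-- Two subsets `A`, `B` of a metric space are *asymptotically disjoint* (for the AS.R.
associated to the metric) if no unbounded `L₁ ⊆ A` and unbounded `L₂ ⊆ B` are
asymptotically alike, i.e. any such `L₁`, `L₂` are at infinite Hausdorff distance. -/
def MetricAsympDisjoint {X : Type*} [MetricSpace X] (A B : Set X) : Prop :=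
  ∀ L₁ ⊆ A, ∀ L₂ ⊆ B, ¬MetricASRBounded L₁ → ¬MetricASRBounded L₂ →
    EMetric.hausdorffEdist L₁ L₂ = ⊤

theorem metricASRBounded_iff_isBounded {X : Type*} [MetricSpace X] (A : Set X) :
    MetricASRBounded A ↔ Bornology.IsBounded A := by
  constructor
  · rintro (rfl | ⟨x, hx⟩)
    · exact Bornology.isBounded_empty
    · refine (Metric.isBounded_iff_subset_closedBall x).2
        ⟨(Metric.hausdorffEDist A {x}).toReal, fun a ha => ?_⟩
      have h : edist a x ≤ Metric.hausdorffEDist A {x} := by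
        simpa using Metric.infEDist_le_hausdorffEDist_of_mem (t := {x}) ha
      rw [Metric.mem_closedBall, dist_edist]
      exact ENNReal.toReal_mono hx h
  · intro h
    rcases A.eq_empty_or_nonempty with hA | ⟨x, hx⟩
    · exact Or.inl hA
    · exact Or.inr ⟨x, Metric.hausdorffEDist_ne_top_of_nonempty_of_bounded ⟨x, hx⟩
        (Set.singleton_nonempty x) h Bornology.isBounded_singleton⟩

theorem not_metricASRBounded_iff {X : Type*} [MetricSpace X] (x₀ : X) (A : Set X) :
    ¬MetricASRBounded A ↔ ∀ r : ℝ, ∃ a ∈ A, r < dist a x₀ := by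
  rw [metricASRBounded_iff_isBounded, Metric.isBounded_iff_subset_closedBall x₀]
  simp [Set.subset_def]

/-- Two unbounded subsets `A` and `B` of a metric space are asymptotically disjoint iff
`lim_{r → ∞} d(A \ B(x₀,r), B \ B(x₀,r)) = ∞`, i.e. for every `N > 0` there is `R > 0`
such that for all `r ≥ R`, every `a ∈ A` with `d(a,x₀) ≥ r` and every `b ∈ B` with
`d(b,x₀) ≥ r` satisfy `d(a,b) > N`. -/
theorem stmt_11 {X : Type*} [MetricSpace X] (x₀ : X) (A B : Set X)
    (hA : ¬MetricASRBounded A) (hB : ¬MetricASRBounded B) :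
    MetricAsympDisjoint A B ↔
      ∀ N > (0 : ℝ), ∃ R > (0 : ℝ), ∀ r ≥ R,
        ∀ a ∈ A, r ≤ dist a x₀ → ∀ b ∈ B, r ≤ dist b x₀ → N < dist a b := by
  constructor
  · intro h N hN
    by_contra! hfar
    have hfar' : ∀ r : ℝ, ∃ a ∈ A, ∃ b ∈ B, r < dist a x₀ ∧ r < dist b x₀ ∧ dist a b ≤ N := by
      intro r
      obtain ⟨s, hs, a, ha, hsa, b, hb, hsb, hab⟩ := hfar (|r| + 1) (by positivity)
      have := le_abs_self r
      exact ⟨a, ha, b, hb, by linarith, by linarith, hab⟩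
    have htop := h {a ∈ A | ∃ b ∈ B, dist a b ≤ N} (Set.sep_subset _ _)
      {b ∈ B | ∃ a ∈ A, dist a b ≤ N} (Set.sep_subset _ _)
      ((not_metricASRBounded_iff x₀ _).2 fun r => by
        obtain ⟨a, ha, b, hb, hra, -, hab⟩ := hfar' r
        exact ⟨a, ⟨ha, b, hb, hab⟩, hra⟩)
      ((not_metricASRBounded_iff x₀ _).2 fun r => by
        obtain ⟨a, ha, b, hb, -, hrb, hab⟩ := hfar' r
        exact ⟨b, ⟨hb, a, ha, hab⟩, hrb⟩)
    refine ne_top_of_le_ne_top (ENNReal.ofReal_ne_top (r := N))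
      (Metric.hausdorffEDist_le_of_mem_edist ?_ ?_) htop
    · rintro a ⟨ha, b, hb, hab⟩
      exact ⟨b, ⟨hb, a, ha, hab⟩, (edist_le_ofReal hN.le).2 hab⟩
    · rintro b ⟨hb, a, ha, hab⟩
      exact ⟨a, ⟨ha, b, hb, hab⟩, (edist_le_ofReal hN.le).2 (by rwa [dist_comm])⟩
  · intro h L₁ hL₁ L₂ hL₂ hu₁ _
    by_contra hfin
    set N : ℝ := (Metric.hausdorffEDist L₁ L₂).toReal + 1
    have hNpos : 0 < N := by positivity
    have hlt : Metric.hausdorffEDist L₁ L₂ < ENNReal.ofReal N :=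
      (ENNReal.lt_ofReal_iff_toReal_lt hfin).2 (lt_add_one _)
    obtain ⟨R, -, hR⟩ := h N hNpos
    obtain ⟨a, ha, hRa⟩ := (not_metricASRBounded_iff x₀ L₁).1 hu₁ (R + N)
    obtain ⟨b, hb, hab⟩ := Metric.exists_edist_lt_of_hausdorffEDist_lt ha hlt
    rw [edist_lt_ofReal] at hab
    have htri := dist_triangle a b x₀
    have := hR R le_rfl a (hL₁ ha) (by linarith) b (hL₂ hb) (by linarith)
    linarith
end

section
/- Let (X,d) be a metric space and let λ be the AS.R. associated to d (A λ B iff d_H(A,B) < ∞). Then (X,λ) is asymptotically normal: for any two asymptotically disjoint subsets A and B of X there exist subsets X₁ and X₂ of X with X = X₁ ∪ X₂ such that A and X₁ are asymptotically disjoint and B and X₂ are asymptotically disjoint. -/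
open Metric in
theorem MetricASRBounded.of_hausdorffEDist_ne_top {X : Type*} [MetricSpace X] {A B : Set X}
    (hB : MetricASRBounded B) (h : hausdorffEDist A B ≠ ⊤) : MetricASRBounded A := by
  rcases hB with rfl | ⟨x, hx⟩
  · refine Or.inl (Set.not_nonempty_iff_eq_empty.mp fun hA => ?_)
    exact Set.not_nonempty_empty (nonempty_of_hausdorffEDist_ne_top hA h)
  · exact Or.inr ⟨x, ne_top_of_le_ne_top (ENNReal.add_ne_top.mpr ⟨h, hx⟩)
      hausdorffEDist_triangle⟩

theorem MetricAsympDisjoint.symm {X : Type*} [MetricSpace X] {A B : Set X}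
    (h : MetricAsympDisjoint A B) : MetricAsympDisjoint B A := by
  intro L₁ h₁ L₂ h₂ u₁ u₂
  exact Metric.hausdorffEDist_comm.trans (h L₂ h₂ L₁ h₁ u₂ u₁)

open Metric in
/-- If every point of `L` is within `r` of `B`, then `L` is at finite Hausdorff distance from
some subset of `B`. -/
theorem exists_subset_hausdorffEDist_ne_top {X : Type*} [MetricSpace X] {L B : Set X}
    {r : ENNReal} (hr : r ≠ ⊤) (h : ∀ y ∈ L, infEDist y B ≤ r) :
    ∃ M ⊆ B, hausdorffEDist L M ≠ ⊤ := by
  refine ⟨{b ∈ B | ∃ y ∈ L, edist y b ≤ r + 1}, Set.sep_subset _ _, ?_⟩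
  refine ne_top_of_le_ne_top (b := r + 1) (by simp [hr]) (hausdorffEDist_le_of_mem_edist ?_ ?_)
  · intro y hy
    obtain ⟨b, hb, hyb⟩ := infEDist_lt_iff.mp
      ((h y hy).trans_lt (ENNReal.lt_add_right hr one_ne_zero))
    exact ⟨b, ⟨hb, y, hy, hyb.le⟩, hyb.le⟩
  · rintro b ⟨-, y, hy, hyb⟩
    exact ⟨y, hy, edist_comm b y ▸ hyb⟩

open Metric in
theorem MetricAsympDisjoint.setOf_infEDist_le {X : Type*} [MetricSpace X] {A B : Set X}
    (h : MetricAsympDisjoint A B) :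
    MetricAsympDisjoint A {x | infEDist x B ≤ infEDist x A} := by
  intro L₁ h₁ L₂ h₂ u₁ u₂
  by_contra hfin
  have hfin' : hausdorffEDist L₁ L₂ ≠ ⊤ := hfin
  obtain ⟨M, hMB, hM⟩ := exists_subset_hausdorffEDist_ne_top (L := L₂) (B := B) hfin' fun y hy =>
    calc infEDist y B ≤ infEDist y A := h₂ hy
      _ ≤ infEDist y L₁ := infEDist_anti h₁
      _ ≤ hausdorffEDist L₂ L₁ := infEDist_le_hausdorffEDist_of_mem hy
      _ = hausdorffEDist L₁ L₂ := hausdorffEDist_comm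
  exact ne_top_of_le_ne_top (ENNReal.add_ne_top.mpr ⟨hfin', hM⟩) hausdorffEDist_triangle
    (h L₁ h₁ M hMB u₁ fun hbM => u₂ (hbM.of_hausdorffEDist_ne_top hM))

/-- A metric space with the AS.R. associated to its metric is *asymptotically normal*:
for any asymptotically disjoint subsets `A`, `B` there are `X₁`, `X₂` with
`X = X₁ ∪ X₂`, `A` asymptotically disjoint from `X₁` and `B` asymptotically disjoint
from `X₂`. -/
theorem stmt_12 {X : Type*} [MetricSpace X] (A B : Set X)
    (h : MetricAsympDisjoint A B) :
    ∃ X₁ X₂ : Set X, X₁ ∪ X₂ = Set.univ ∧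
      MetricAsympDisjoint A X₁ ∧ MetricAsympDisjoint B X₂ := by
  refine ⟨{x | Metric.infEDist x B ≤ Metric.infEDist x A},
    {x | Metric.infEDist x A ≤ Metric.infEDist x B}, ?_, h.setOf_infEDist_le,
    h.symm.setOf_infEDist_le⟩
  exact Set.eq_univ_of_forall fun x => le_total (Metric.infEDist x B) (Metric.infEDist x A)
end

section
/- Let X be a topological space and let λ be a proper, asymptotically connected AS.R. on X compatible with the topology. Then a subset A of X is bounded if and only if the closure of A is compact. -/
/-- An AS.R. `l` on a topological space is *compatible with the topology* if every subset
has an asymptotic neighbourhood (an open superset asymptotically alike to it) and every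
subset is asymptotically alike to its closure. -/
def ASRCompatible {X : Type*} [TopologicalSpace X] (l : Set X → Set X → Prop) : Prop :=
  (∀ A : Set X, ∃ U : Set X, IsOpen U ∧ A ⊆ U ∧ l A U) ∧
  ∀ A : Set X, l A (closure A)

theorem IsASR.bounded_mono {X : Type*} {l : Set X → Set X → Prop} (hl : IsASR l)
    {B C : Set X} (hBC : B ⊆ C) (hC : ASRBounded l C) : ASRBounded l B := by
  rcases B.eq_empty_or_nonempty with hB | hB
  · exact Or.inl hB
  rcases hC with rfl | ⟨x, hx⟩
  · exact Or.inl (Set.subset_empty_iff.mp hBC)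
  rw [← Set.union_eq_self_of_subset_left hBC] at hx
  obtain ⟨A₁, A₂, hA₁, -, hA, h₁, -⟩ := hl.split hx hB (hB.mono hBC)
  have hA₁x : A₁ ⊆ {x} := hA ▸ Set.subset_union_left
  rw [hA₁.subset_singleton_iff.mp hA₁x] at h₁
  exact Or.inr ⟨x, h₁⟩

theorem IsASR.bounded_union {X : Type*} {l : Set X → Set X → Prop} (hl : IsASR l)
    (hconn : ∀ x y : X, l {x} {y}) {B C : Set X} (hB : ASRBounded l B)
    (hC : ASRBounded l C) : ASRBounded l (B ∪ C) := by
  rcases hB with rfl | ⟨x, hx⟩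
  · rwa [Set.empty_union]
  rcases hC with rfl | ⟨y, hy⟩
  · rw [Set.union_empty]
    exact Or.inr ⟨x, hx⟩
  refine Or.inr ⟨x, ?_⟩
  have h := hl.union hx (hl.equiv.trans hy (hconn y x))
  rwa [Set.union_self] at h

theorem IsASR.bounded_of_isCompact {X : Type*} [TopologicalSpace X]
    {l : Set X → Set X → Prop} (hl : IsASR l) (hcomp : ASRCompatible l)
    (hconn : ∀ x y : X, l {x} {y}) {K : Set X} (hK : IsCompact K) : ASRBounded l K := by
  refine hK.induction_on (Or.inl rfl) (fun _ _ h => hl.bounded_mono h)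
    (fun _ _ => hl.bounded_union hconn) fun x _ => ?_
  obtain ⟨U, hU, hxU, hlU⟩ := hcomp.1 {x}
  exact ⟨U, mem_nhdsWithin_of_mem_nhds (hU.mem_nhds (hxU rfl)),
    Or.inr ⟨x, hl.equiv.symm hlU⟩⟩

/-- If `l` is a proper (every bounded set has compact closure), asymptotically connected
AS.R. compatible with the topology of `X`, then a subset is bounded iff its closure is
compact. -/
theorem stmt_13 {X : Type*} [TopologicalSpace X] (l : Set X → Set X → Prop)
    (hl : IsASR l) (hcomp : ASRCompatible l)
    (hproper : ∀ A : Set X, ASRBounded l A → IsCompact (closure A))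
    (hconn : ∀ x y : X, l {x} {y}) (A : Set X) :
    ASRBounded l A ↔ IsCompact (closure A) :=
  ⟨hproper A, fun h => hl.bounded_mono subset_closure (hl.bounded_of_isCompact hcomp hconn h)⟩
end

section
/- Let (X,λ) be an AS.R. space, let Y be a nonempty subset of X with the subspace AS.R. λ_Y, and let n be a natural number. If asdim_λ X ≤ n then asdim_{λ_Y} Y ≤ n. -/
/-- `S_𝒰 = ⋃_{U ∈ 𝒰} U × U`. -/
def SU {X : Type*} (U : Set (Set X)) : Set (X × X) :=
  ⋃ u ∈ U, u ×ˢ u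

/-- `A ∼_𝒰 B` iff `A ⊆ S_𝒰(B)` and `B ⊆ S_𝒰(A)`. -/
def simU {X : Type*} (U : Set (Set X)) (A B : Set X) : Prop :=
  A ⊆ entImage (SU U) B ∧ B ⊆ entImage (SU U) A

/-- A family `𝒰` of subsets of an AS.R. space `(X, l)` is *uniformly bounded* if every
member is bounded and `A ∼_𝒰 B` implies `A λ B`. -/
def UnifBoundedASR {X : Type*} (l : Set X → Set X → Prop) (U : Set (Set X)) : Prop :=
  (∀ u ∈ U, ASRBounded l u) ∧ ∀ A B : Set X, simU U A B → l A B

/-- `μ(𝒱) ≤ m`: at most `m` members of `𝒱` meet any given point. -/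
def MultiplicityLE {X : Type*} (V : Set (Set X)) (m : ℕ) : Prop :=
  ∀ (x : X) (S : Finset (Set X)), (↑S : Set (Set X)) ⊆ {v ∈ V | x ∈ v} → S.card ≤ m

/-- `𝒰` refines `𝒱`: every member of `𝒰` is contained in some member of `𝒱`. -/
def Refines {X : Type*} (U V : Set (Set X)) : Prop :=
  ∀ u ∈ U, ∃ v ∈ V, u ⊆ v

/-- `asdim_l X ≤ n`: every uniformly bounded cover `𝒰` of `X` refines some uniformly
bounded cover `𝒱` of `X` of multiplicity at most `n + 1`. -/
def AsdimLE {X : Type*} (l : Set X → Set X → Prop) (n : ℕ) : Prop :=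
  ∀ U : Set (Set X), UnifBoundedASR l U → ⋃₀ U = Set.univ →
    ∃ V : Set (Set X), UnifBoundedASR l V ∧ ⋃₀ V = Set.univ ∧
      Refines U V ∧ MultiplicityLE V (n + 1)

theorem mem_entImage_SU {X : Type*} {U : Set (Set X)} {A : Set X} {y : X} :
    y ∈ entImage (SU U) A ↔ ∃ x ∈ A, ∃ u ∈ U, x ∈ u ∧ y ∈ u := by
  simp [entImage, SU, and_left_comm]

/-- The image in `X` of a family of subsets of `Y`, completed by all singletons to a cover
of `X`. -/
def coverExtension {X : Type*} {Y : Set X} (U : Set (Set Y)) : Set (Set X) :=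
  Set.image Subtype.val '' U ∪ Set.range singleton

theorem sUnion_coverExtension {X : Type*} {Y : Set X} (U : Set (Set Y)) :
    ⋃₀ coverExtension U = Set.univ :=
  Set.eq_univ_of_forall fun x => ⟨{x}, Or.inr ⟨x, rfl⟩, rfl⟩

theorem preimage_subset_entImage {X : Type*} {Y : Set X} {U : Set (Set Y)}
    (hU : ⋃₀ U = Set.univ) {A B : Set X} (h : A ⊆ entImage (SU (coverExtension U)) B) :
    (Subtype.val ⁻¹' A : Set Y) ⊆ entImage (SU U) (Subtype.val ⁻¹' B) := by
  intro y hy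
  rw [mem_entImage_SU]
  obtain ⟨x, hx, _, ⟨u, hu, rfl⟩ | ⟨z, rfl⟩, hxu, hyu⟩ := mem_entImage_SU.1 (h hy)
  · obtain ⟨x, hxu, rfl⟩ := hxu
    obtain ⟨y', hyu, hyy⟩ := hyu
    exact ⟨x, hx, u, hu, hxu, Subtype.ext hyy ▸ hyu⟩
  · obtain rfl : x = z := hxu
    obtain rfl : (y : X) = x := hyu
    obtain ⟨u, hu, hyu⟩ := Set.mem_sUnion.1 (hU ▸ Set.mem_univ y)
    exact ⟨y, hx, u, hu, hyu, hyu⟩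

theorem diff_subset_of_subset_entImage {X : Type*} {Y : Set X} {U : Set (Set Y)} {A B : Set X}
    (h : A ⊆ entImage (SU (coverExtension U)) B) : A \ Y ⊆ B \ Y := by
  rintro y ⟨hy, hyY⟩
  obtain ⟨x, hx, _, ⟨u, hu, rfl⟩ | ⟨z, rfl⟩, hxu, hyu⟩ := mem_entImage_SU.1 (h hy)
  · obtain ⟨y, -, rfl⟩ := hyu
    exact absurd y.2 hyY
  · obtain rfl : x = z := hxu
    obtain rfl : y = x := hyu
    exact ⟨hx, hyY⟩

theorem UnifBoundedASR.extend_cover {X : Type*} {l : Set X → Set X → Prop} (hl : IsASR l)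
    {Y : Set X} {U : Set (Set Y)} (hU : UnifBoundedASR (SubspaceASR l Y) U)
    (hcov : ⋃₀ U = Set.univ) : UnifBoundedASR l (coverExtension U) := by
  refine ⟨?_, fun A B hAB => ?_⟩
  · rintro _ (⟨u, hu, rfl⟩ | ⟨x, rfl⟩)
    · rcases hU.1 u hu with rfl | ⟨x, hx⟩
      · exact Or.inl (Set.image_empty _)
      · exact Or.inr ⟨x, by simpa [SubspaceASR] using hx⟩
    · exact Or.inr ⟨x, hl.equiv.refl _⟩
  · have hY := hU.2 _ _
      ⟨preimage_subset_entImage hcov hAB.1, preimage_subset_entImage hcov hAB.2⟩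
    have hdiff : A \ Y = B \ Y := (diff_subset_of_subset_entImage hAB.1).antisymm
      (diff_subset_of_subset_entImage hAB.2)
    have hdiff' : l (A \ Y) (B \ Y) := by
      rw [hdiff]
      exact hl.equiv.refl _
    have hunion := hl.union hY hdiff'
    simpa only [Subtype.image_preimage_coe, Set.inter_comm Y, Set.inter_union_sdiff]
      using hunion

theorem image_subset_entImage {X : Type*} {Y : Set X} {V : Set (Set X)} {A B : Set Y}
    (h : A ⊆ entImage (SU (Set.preimage Subtype.val '' V)) B) :
    Subtype.val '' A ⊆ entImage (SU V) (Subtype.val '' B) := by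
  rintro _ ⟨y, hy, rfl⟩
  obtain ⟨x, hx, _, ⟨v, hv, rfl⟩, hxv, hyv⟩ := mem_entImage_SU.1 (h hy)
  exact mem_entImage_SU.2 ⟨x, ⟨x, hx, rfl⟩, v, hv, hxv, hyv⟩

theorem UnifBoundedASR.preimage_val {X : Type*} {l : Set X → Set X → Prop} {V : Set (Set X)}
    (hV : UnifBoundedASR l V) (Y : Set X) :
    UnifBoundedASR (SubspaceASR l Y) (Set.preimage Subtype.val '' V) := by
  have hsim : ∀ A B : Set Y, simU (Set.preimage Subtype.val '' V) A B → SubspaceASR l Y A B :=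
    fun A B hAB => hV.2 _ _ ⟨image_subset_entImage hAB.1, image_subset_entImage hAB.2⟩
  refine ⟨?_, hsim⟩
  rintro w hw
  rcases w.eq_empty_or_nonempty with rfl | ⟨y, hy⟩
  · exact Or.inl rfl
  · refine Or.inr ⟨y, hsim _ _ ⟨fun z hz => ?_, ?_⟩⟩
    · exact mem_entImage_SU.2 ⟨y, rfl, w, hw, hy, hz⟩
    · exact Set.singleton_subset_iff.2 (mem_entImage_SU.2 ⟨y, hy, w, hw, hy, hy⟩)

theorem MultiplicityLE.image_preimage {X Z : Type*} {V : Set (Set X)} {m : ℕ}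
    (hV : MultiplicityLE V m) (f : Z → X) : MultiplicityLE (Set.preimage f '' V) m := by
  classical
  intro z S hS
  choose! g hgV hg using fun s (hs : s ∈ S) => (hS hs).1
  have hinj : Set.InjOn g S := fun s hs t ht hst => by rw [← hg s hs, ← hg t ht, hst]
  rw [← Finset.card_image_of_injOn hinj]
  refine hV (f z) _ fun v hv => ?_
  obtain ⟨s, hs, rfl⟩ := Finset.mem_image.1 hv
  have hz : z ∈ f ⁻¹' g s := (hg s hs).symm ▸ (hS hs).2
  exact ⟨hgV s hs, hz⟩

/-- For a nonempty subset `Y` of an AS.R. space `(X, l)` with the subspace AS.R.,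
`asdim Y ≤ asdim X`: if `asdim_l X ≤ n` then `asdim_{l_Y} Y ≤ n`. -/
theorem stmt_15 {X : Type*} (l : Set X → Set X → Prop) (hl : IsASR l)
    (Y : Set X) (hY : Y.Nonempty) (n : ℕ) (h : AsdimLE l n) :
    AsdimLE (SubspaceASR l Y) n := by
  intro U hU hcov
  obtain ⟨V, hVb, hVcov, href, hmul⟩ :=
    h (coverExtension U) (hU.extend_cover hl hcov) (sUnion_coverExtension U)
  refine ⟨_, hVb.preimage_val Y, Set.eq_univ_of_forall fun y => ?_, fun u hu => ?_,
    hmul.image_preimage Subtype.val⟩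
  · obtain ⟨v, hv, hyv⟩ := Set.mem_sUnion.1 (hVcov ▸ Set.mem_univ (y : X))
    exact ⟨_, ⟨v, hv, rfl⟩, hyv⟩
  · obtain ⟨v, hv, huv⟩ := href _ (Or.inl ⟨u, hu, rfl⟩)
    exact ⟨_, ⟨v, hv, rfl⟩, Set.image_subset_iff.1 huv⟩
end

section
/- Let ℰ be a coarse structure on a set X. Then the relation λ_ℰ defined by A λ_ℰ B iff there exists E ∈ ℰ with A ⊆ E(B) and B ⊆ E(A) is an asymptotic resemblance on X: it is an equivalence relation on the family of all subsets of X and satisfies (i) if A₁ λ_ℰ B₁ and A₂ λ_ℰ B₂ then (A₁ ∪ A₂) λ_ℰ (B₁ ∪ B₂), and (ii) if (B₁ ∪ B₂) λ_ℰ A with B₁, B₂ nonempty, then there exist nonempty A₁, A₂ ⊆ A with A = A₁ ∪ A₂, B₁ λ_ℰ A₁ and B₂ λ_ℰ A₂. -/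
theorem entImage_mono {X : Type*} {e f : Set (X × X)} {A B : Set X} (hef : e ⊆ f)
    (hAB : A ⊆ B) : entImage e A ⊆ entImage f B := by
  rintro y ⟨x, hx, hxy⟩
  exact ⟨x, hAB hx, hef hxy⟩

theorem subset_entImage_comp {X : Type*} {e f : Set (X × X)} {A B C : Set X}
    (hAB : A ⊆ entImage e B) (hBC : B ⊆ entImage f C) :
    A ⊆ entImage {p : X × X | ∃ z : X, (p.1, z) ∈ f ∧ (z, p.2) ∈ e} C := by
  intro a ha
  obtain ⟨b, hb, hba⟩ := hAB ha
  obtain ⟨c, hc, hcb⟩ := hBC hb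
  exact ⟨c, hc, b, hcb, hba⟩

namespace coarseASR

variable {X : Type*} {E : Set (Set (X × X))}

theorem refl (hE : IsCoarseStructure E) (A : Set X) : coarseASR E A A :=
  ⟨_, hE.diag, fun a ha => ⟨a, ha, rfl⟩, fun a ha => ⟨a, ha, rfl⟩⟩

theorem symm {A B : Set X} : coarseASR E A B → coarseASR E B A := by
  rintro ⟨e, he, hAB, hBA⟩
  exact ⟨e, he, hBA, hAB⟩

theorem trans (hE : IsCoarseStructure E) {A B C : Set X} :
    coarseASR E A B → coarseASR E B C → coarseASR E A C := by
  rintro ⟨e, he, hAB, hBA⟩ ⟨f, hf, hBC, hCB⟩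
  exact ⟨_, hE.union (hE.comp he hf) (hE.comp hf he),
    (subset_entImage_comp hAB hBC).trans (entImage_mono Set.subset_union_left subset_rfl),
    (subset_entImage_comp hCB hBA).trans (entImage_mono Set.subset_union_right subset_rfl)⟩

theorem union (hE : IsCoarseStructure E) {A₁ B₁ A₂ B₂ : Set X} :
    coarseASR E A₁ B₁ → coarseASR E A₂ B₂ → coarseASR E (A₁ ∪ A₂) (B₁ ∪ B₂) := by
  rintro ⟨e, he, hAB₁, hBA₁⟩ ⟨f, hf, hAB₂, hBA₂⟩
  refine ⟨e ∪ f, hE.union he hf, Set.union_subset ?_ ?_, Set.union_subset ?_ ?_⟩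
  · exact hAB₁.trans (entImage_mono Set.subset_union_left Set.subset_union_left)
  · exact hAB₂.trans (entImage_mono Set.subset_union_right Set.subset_union_right)
  · exact hBA₁.trans (entImage_mono Set.subset_union_left Set.subset_union_left)
  · exact hBA₂.trans (entImage_mono Set.subset_union_right Set.subset_union_right)

/-- Related sets are related by a symmetric entourage. -/
theorem exists_symmetric (hE : IsCoarseStructure E) {A B : Set X} (h : coarseASR E A B) :
    ∃ e ∈ E, (∀ x y, (x, y) ∈ e → (y, x) ∈ e) ∧ A ⊆ entImage e B ∧ B ⊆ entImage e A := by
  obtain ⟨e, he, hAB, hBA⟩ := h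
  exact ⟨_, hE.union he (hE.inv he), fun _ _ h => h.symm,
    hAB.trans (entImage_mono Set.subset_union_left subset_rfl),
    hBA.trans (entImage_mono Set.subset_union_left subset_rfl)⟩

theorem inter_entImage {e : Set (X × X)} (he : e ∈ E) (hsymm : ∀ x y, (x, y) ∈ e → (y, x) ∈ e)
    {A B : Set X} (hBA : B ⊆ entImage e A) : coarseASR E B (A ∩ entImage e B) := by
  refine ⟨e, he, fun b hb => ?_, Set.inter_subset_right⟩
  obtain ⟨a, ha, hab⟩ := hBA hb
  exact ⟨a, ⟨ha, b, hb, hsymm _ _ hab⟩, hab⟩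

theorem nonempty {A B : Set X} (h : coarseASR E A B) (hA : A.Nonempty) : B.Nonempty := by
  obtain ⟨e, -, hAB, -⟩ := h
  obtain ⟨a, ha⟩ := hA
  obtain ⟨b, hb, -⟩ := hAB ha
  exact ⟨b, hb⟩

end coarseASR

/-- The relation `λ_ℰ` associated to a coarse structure `ℰ` is an asymptotic
resemblance on `X`. -/
theorem stmt_18 {X : Type*} (E : Set (Set (X × X))) (hE : IsCoarseStructure E) :
    IsASR (coarseASR E) := by
  refine ⟨⟨coarseASR.refl hE, coarseASR.symm, coarseASR.trans hE⟩,
    fun _ _ _ _ => coarseASR.union hE, fun B₁ B₂ A h hB₁ hB₂ => ?_⟩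
  obtain ⟨e, he, hsymm, hBA, hAB⟩ := coarseASR.exists_symmetric hE h
  have h₁ := coarseASR.inter_entImage he hsymm (Set.subset_union_left.trans hBA)
  have h₂ := coarseASR.inter_entImage he hsymm (Set.subset_union_right.trans hBA)
  refine ⟨_, _, h₁.nonempty hB₁, h₂.nonempty hB₂, ?_, h₁, h₂⟩
  rw [← Set.inter_union_distrib_left, eq_comm, Set.inter_eq_left]
  intro a ha
  obtain ⟨b, hb | hb, hba⟩ := hAB ha
  · exact Or.inl ⟨b, hb, hba⟩
  · exact Or.inr ⟨b, hb, hba⟩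
end
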